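/- For every λ>0 and b∈(0,1), δ_∞(λ,b) := b·(I_1(λ)·K_1(λ) + I_1(λb)·K_1(λb)) − (1+b²)·I_1(λb)·K_1(λ) > 0. -/

import Mathlib

open Real MeasureTheory Filter

/-- Modified Bessel function of the first kind `I_n`. -/
noncomputable def besselI (n : ℕ) (x : ℝ) : ℝ :=
  ∑' m : ℕ, (x / 2) ^ (n + 2 * m) / ((Nat.factorial m : ℝ) * (Nat.factorial (n + m) : ℝ))

/-- Modified Bessel function of the second kind `K_n`. -/
noncomputable def besselK (n : ℕ) (x : ℝ) : ℝ :=
  ∫ t in Set.Ioi (0 : ℝ), Real.exp (-x * Real.cosh t) * Real.cosh ((n : ℝ) * t)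

/-- `Λ_n(λ,b) = I_n(λb) K_n(λ)`. -/
noncomputable def Lam (n : ℕ) (l b : ℝ) : ℝ := besselI n (l * b) * besselK n l

/-- `Ω_n(x) = I_1(x)K_1(x) − I_n(x)K_n(x)`. -/
noncomputable def Om (n : ℕ) (x : ℝ) : ℝ :=
  besselI 1 x * besselK 1 x - besselI n x * besselK n x

/-- Discriminant `Δ_n(λ,b)`. -/
noncomputable def Del (n : ℕ) (l b : ℝ) : ℝ :=
  (b * (Om n l + Om n (l * b)) - (1 + b ^ 2) * Lam 1 l b) ^ 2 - 4 * b ^ 2 * Lam n l b ^ 2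

/-- `B_n(λ,b)`. -/
noncomputable def Bfun (n : ℕ) (l b : ℝ) : ℝ :=
  (1 - b ^ 2) * Lam 1 l b + b * (Om n l - Om n (l * b))

/-- `Ω_n^+(λ,b)`. -/
noncomputable def OmP (n : ℕ) (l b : ℝ) : ℝ :=
  (Bfun n l b + Real.sqrt (Del n l b)) / (2 * b)

/-- `Ω_n^−(λ,b)`. -/
noncomputable def OmM (n : ℕ) (l b : ℝ) : ℝ :=
  (Bfun n l b - Real.sqrt (Del n l b)) / (2 * b)

/-- The matrix `M_n(λ,b,Ω)`. -/
noncomputable def Mmat (n : ℕ) (l b W : ℝ) : Matrix (Fin 2) (Fin 2) ℝ :=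
  !![Om n l - W - b * Lam 1 l b, b * Lam n l b;
     -Lam n l b, Lam 1 l b - b * (Om n (l * b) + W)]

theorem summable_besselI (n : ℕ) (x : ℝ) :
    Summable fun m : ℕ =>
      (x / 2) ^ (n + 2 * m) / ((Nat.factorial m : ℝ) * (Nat.factorial (n + m) : ℝ)) := by
  refine Summable.of_norm_bounded
    (((Real.summable_pow_div_factorial ((x / 2) ^ 2)).mul_left (|x / 2| ^ n))) fun m => ?_
  have hfac : (1 : ℝ) ≤ Nat.factorial (n + m) := by exact_mod_cast Nat.factorial_pos (n + m)
  have hm : (0 : ℝ) < Nat.factorial m := by exact_mod_cast Nat.factorial_pos m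
  rw [norm_div, norm_mul, norm_pow, Real.norm_eq_abs, Real.norm_natCast, Real.norm_natCast,
    pow_add, pow_mul, sq_abs, ← mul_div_assoc]
  gcongr
  exact le_mul_of_one_le_right hm.le hfac

theorem besselI_pos (n : ℕ) {x : ℝ} (hx : 0 < x) : 0 < besselI n x :=
  (summable_besselI n x).tsum_pos (fun m => by positivity) 0 (by positivity)

/-- The function `x ↦ I_n(x) / x ^ n` is increasing, in scaled form. -/
theorem besselI_mul_le (n : ℕ) {x b : ℝ} (hx : 0 ≤ x) (hb0 : 0 ≤ b) (hb1 : b ≤ 1) :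
    besselI n (x * b) ≤ b ^ n * besselI n x := by
  unfold besselI
  rw [← tsum_mul_left]
  refine (summable_besselI n _).tsum_le_tsum (fun m => ?_) ((summable_besselI n x).mul_left _)
  rw [← mul_div_assoc, mul_div_right_comm, mul_pow, mul_comm]
  gcongr ?_ * _ / _
  exact pow_le_pow_of_le_one hb0 hb1 (Nat.le_add_right n _)

theorem integrableOn_besselK (n : ℕ) {x : ℝ} (hx : 0 < x) :
    IntegrableOn (fun t : ℝ => Real.exp (-x * Real.cosh t) * Real.cosh ((n : ℝ) * t))
      (Set.Ioi 0) := by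
  have hdom : IntegrableOn
      (fun t : ℝ => Real.exp (2 * n ^ 2 / x) * Real.exp (-(x / 8) * t ^ 2)) (Set.Ioi 0) :=
    ((integrable_exp_neg_mul_sq (by positivity)).const_mul _).integrableOn
  refine hdom.mono' (by fun_prop) ?_
  filter_upwards [ae_restrict_mem measurableSet_Ioi] with t ht
  have ht : 0 < t := ht
  have hcosh : t ^ 2 / 4 ≤ Real.cosh t := by
    rw [Real.cosh_eq]
    linarith [Real.quadratic_le_exp_of_nonneg ht.le, Real.exp_pos (-t)]
  have hcosh' : Real.cosh (n * t) ≤ Real.exp (n * t) := by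
    have hle : Real.exp (-(n * t)) ≤ Real.exp (n * t) :=
      Real.exp_le_exp.2 (neg_le_self (by positivity))
    rw [Real.cosh_eq]
    linarith
  have hyoung : (n : ℝ) * t ≤ 2 * n ^ 2 / x + x / 8 * t ^ 2 := by
    have hsq : 2 * (n : ℝ) ^ 2 / x + x / 8 * t ^ 2 - n * t = (x * t - 4 * n) ^ 2 / (8 * x) := by
      field_simp
      ring
    have : 0 ≤ (x * t - 4 * n) ^ 2 / (8 * x) := by positivity
    linarith
  rw [Real.norm_of_nonneg (mul_nonneg (Real.exp_pos _).le (Real.cosh_pos _).le), ← Real.exp_add]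
  calc Real.exp (-x * Real.cosh t) * Real.cosh (n * t)
      ≤ Real.exp (-x * Real.cosh t) * Real.exp (n * t) := by gcongr
    _ = Real.exp (-x * Real.cosh t + n * t) := (Real.exp_add _ _).symm
    _ ≤ _ := Real.exp_le_exp.2 (by linarith [mul_le_mul_of_nonneg_left hcosh hx.le])

theorem besselK_pos (n : ℕ) {x : ℝ} (hx : 0 < x) : 0 < besselK n x := by
  have hpos : ∀ t : ℝ, 0 < Real.exp (-x * Real.cosh t) * Real.cosh ((n : ℝ) * t) := fun t =>
    mul_pos (Real.exp_pos _) (Real.cosh_pos _)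
  unfold besselK
  rw [setIntegral_pos_iff_support_of_nonneg_ae (ae_of_all _ fun t => (hpos t).le)
    (integrableOn_besselK n hx),
    Function.support_eq_univ fun t => (hpos t).ne', Set.univ_inter, Real.volume_Ioi]
  exact ENNReal.zero_lt_top

theorem besselK_antitoneOn (n : ℕ) : AntitoneOn (besselK n) (Set.Ioi 0) := by
  intro x hx y hy hxy
  refine integral_mono (integrableOn_besselK n hy) (integrableOn_besselK n hx) fun t => ?_
  have hcosh := Real.cosh_pos t
  have hcosh' := Real.cosh_pos (n * t)
  dsimp only
  gcongr

/-- `δ_∞(λ,b) > 0` for all `λ>0`, `b∈(0,1)`. -/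
theorem delta_infty_pos (l b : ℝ) (hl : 0 < l) (hb : b ∈ Set.Ioo (0:ℝ) 1) :
    0 < b * (besselI 1 l * besselK 1 l + besselI 1 (l * b) * besselK 1 (l * b))
        - (1 + b ^ 2) * (besselI 1 (l * b) * besselK 1 l) := by
  obtain ⟨hb0, hb1⟩ := hb
  have hlb : 0 < l * b := mul_pos hl hb0
  have hI := besselI_mul_le 1 hl.le hb0.le hb1.le
  rw [pow_one] at hI
  have hK : besselK 1 l ≤ besselK 1 (l * b) :=
    besselK_antitoneOn 1 hlb hl (mul_le_of_le_one_right hl.le hb1.le)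
  have hKpos := besselK_pos 1 hl
  have hIpos := besselI_pos 1 hlb
  have hfirst := mul_le_mul_of_nonneg_right hI hKpos.le
  have hsecond := mul_le_mul_of_nonneg_left hK (mul_pos hb0 hIpos).le
  have hgap : 0 < b * (1 - b) * (besselI 1 (l * b) * besselK 1 l) :=
    mul_pos (mul_pos hb0 (sub_pos.2 hb1)) (mul_pos hIpos hKpos)
  linarith
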